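/- Let g and ḡ be projectively equivalent metrics on U, let λ := (1/2)·trace(L), let k ≥ 1, and let p ∈ U. If all partial derivatives of λ of orders 1 through k vanish at p, then the difference of the Christoffel symbols Γ̄^i_{jk} − Γ^i_{jk} of ḡ and g vanishes at p together with all its partial derivatives of order ≤ k−1. -/

import Mathlib

open Matrix

noncomputable section

/-- Partial derivative in the `i`-th coordinate direction of a real-valued function on `ℝⁿ`. -/
def pd {n : ℕ} (i : Fin n) (f : (Fin n → ℝ) → ℝ) : (Fin n → ℝ) → ℝ :=
  fun x => fderiv ℝ f x (Pi.single i 1)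

/-- Iterated partial derivatives along a list of coordinate directions. -/
def iterPD {n : ℕ} : List (Fin n) → ((Fin n → ℝ) → ℝ) → ((Fin n → ℝ) → ℝ)
  | [], f => f
  | i :: l, f => pd i (iterPD l f)

/-- `g` is a (pseudo-Riemannian) metric on `U`: a smooth field of invertible symmetric
real `n×n` matrices. -/
structure IsMetricOn {n : ℕ} (U : Set (Fin n → ℝ))
    (g : (Fin n → ℝ) → Matrix (Fin n) (Fin n) ℝ) : Prop where
  smooth : ∀ i j : Fin n, ContDiffOn ℝ (⊤ : ℕ∞) (fun x => g x i j) U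
  symm : ∀ x ∈ U, (g x).IsSymm
  nondeg : ∀ x ∈ U, IsUnit (g x).det

/-- The Christoffel symbols `Γ^k_{ij}` of the metric `g`. -/
def Gamma {n : ℕ} (g : (Fin n → ℝ) → Matrix (Fin n) (Fin n) ℝ)
    (k i j : Fin n) (x : Fin n → ℝ) : ℝ :=
  (1/2) * ∑ ℓ, (g x)⁻¹ k ℓ *
    (pd i (fun y => g y ℓ j) x + pd j (fun y => g y ℓ i) x - pd ℓ (fun y => g y i j) x)

/-- An open interval of `ℝ` (possibly empty or unbounded): an open order-connected set. -/
def IsOpenInterval (I : Set ℝ) : Prop := IsOpen I ∧ I.OrdConnected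

/-- `γ` is a `g`-geodesic defined on the open interval `I`, with values in `U`. -/
structure IsGeodesicOn {n : ℕ} (U : Set (Fin n → ℝ))
    (g : (Fin n → ℝ) → Matrix (Fin n) (Fin n) ℝ)
    (γ : ℝ → (Fin n → ℝ)) (I : Set ℝ) : Prop where
  interval : IsOpenInterval I
  smooth : ∀ k : Fin n, ContDiffOn ℝ (⊤ : ℕ∞) (fun s => γ s k) I
  mem : ∀ t ∈ I, γ t ∈ U
  eqn : ∀ t ∈ I, ∀ k : Fin n,
    deriv (deriv fun s => γ s k) t
      + ∑ i, ∑ j, Gamma g k i j (γ t) * deriv (fun s => γ s i) t * deriv (fun s => γ s j) t = 0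

/-- `g` and `gbar` are projectively equivalent on `U`: every `g`-geodesic with nowhere
vanishing velocity becomes, after a smooth reparameterization (a diffeomorphism of open
intervals), a `gbar`-geodesic. -/
def ProjEquiv {n : ℕ} (U : Set (Fin n → ℝ))
    (g gbar : (Fin n → ℝ) → Matrix (Fin n) (Fin n) ℝ) : Prop :=
  ∀ (γ : ℝ → (Fin n → ℝ)) (I : Set ℝ), IsGeodesicOn U g γ I →
    (∀ t ∈ I, ∃ k, deriv (fun s => γ s k) t ≠ 0) →
    ∃ (φ : ℝ → ℝ) (J : Set ℝ), IsOpenInterval J ∧ ContDiffOn ℝ (⊤ : ℕ∞) φ J ∧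
      Set.InjOn φ J ∧ φ '' J = I ∧ (∀ t ∈ J, deriv φ t ≠ 0) ∧
      IsGeodesicOn U gbar (γ ∘ φ) J

/-- The (1,1)-tensor `L = |det gbar / det g|^{1/(n+1)} gbar⁻¹ g` built from `g` and `gbar`. -/
def Lfield {n : ℕ} (g gbar : (Fin n → ℝ) → Matrix (Fin n) (Fin n) ℝ)
    (x : Fin n → ℝ) : Matrix (Fin n) (Fin n) ℝ :=
  |(gbar x).det / (g x).det| ^ ((1 : ℝ)/((n : ℝ)+1)) • ((gbar x)⁻¹ * g x)

/-- The family `S(t) = adjugate (t·Id − L)`. -/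
def Sfield {n : ℕ} (g gbar : (Fin n → ℝ) → Matrix (Fin n) (Fin n) ℝ) (t : ℝ)
    (x : Fin n → ℝ) : Matrix (Fin n) (Fin n) ℝ :=
  (t • (1 : Matrix (Fin n) (Fin n) ℝ) - Lfield g gbar x).adjugate

/-- The second order operator associated (via Carter's quantization) to a field `A` of
symmetric matrices: `Â f = |det g|^{-1/2} ∑ᵢⱼ ∂ᵢ(|det g|^{1/2} Aⁱʲ ∂ⱼ f)`. -/
def assocOp {n : ℕ} (g A : (Fin n → ℝ) → Matrix (Fin n) (Fin n) ℝ)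
    (f : (Fin n → ℝ) → ℝ) (x : Fin n → ℝ) : ℝ :=
  |(g x).det| ^ (-(1 : ℝ)/2) * ∑ i, ∑ j,
    pd i (fun y => |(g y).det| ^ ((1 : ℝ)/2) * A y i j * pd j f y) x

/-- The operator `K̂^{(t)}`, associated to `A = S(t)·g⁻¹`. -/
def Khat {n : ℕ} (g gbar : (Fin n → ℝ) → Matrix (Fin n) (Fin n) ℝ) (t : ℝ)
    (f : (Fin n → ℝ) → ℝ) (x : Fin n → ℝ) : ℝ :=
  assocOp g (fun y => Sfield g gbar t y * (g y)⁻¹) f x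

/-- The Beltrami-Laplace operator of `g`, associated to `A = g⁻¹`. -/
def LaplaceOp {n : ℕ} (g : (Fin n → ℝ) → Matrix (Fin n) (Fin n) ℝ)
    (f : (Fin n → ℝ) → ℝ) (x : Fin n → ℝ) : ℝ :=
  assocOp g (fun y => (g y)⁻¹) f x

/-- `K` is a Killing tensor for `g` on `U`: the associated quadratic function is constant
along every `g`-geodesic. -/
def IsKillingTensorOn {n : ℕ} (U : Set (Fin n → ℝ))
    (g K : (Fin n → ℝ) → Matrix (Fin n) (Fin n) ℝ) : Prop :=
  ∀ (γ : ℝ → (Fin n → ℝ)) (I : Set ℝ), IsGeodesicOn U g γ I →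
    ∀ τ₁ ∈ I, ∀ τ₂ ∈ I,
      (∑ i, ∑ j, deriv (fun s => γ s i) τ₁ * K (γ τ₁) i j * deriv (fun s => γ s j) τ₁) =
      (∑ i, ∑ j, deriv (fun s => γ s i) τ₂ * K (γ τ₂) i j * deriv (fun s => γ s j) τ₂)

/-- The covariant derivative `∇_k T_{ij}` of a (0,2)-tensor field `T`. -/
def covDeriv2 {n : ℕ} (g T : (Fin n → ℝ) → Matrix (Fin n) (Fin n) ℝ)
    (k i j : Fin n) (x : Fin n → ℝ) : ℝ :=
  pd k (fun y => T y i j) x - (∑ s, Gamma g s k i x * T x s j)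
    - ∑ s, Gamma g s k j x * T x i s

/-- The Ricci curvature tensor `R_{ij}` of `g`. -/
def Ricci {n : ℕ} (g : (Fin n → ℝ) → Matrix (Fin n) (Fin n) ℝ)
    (i j : Fin n) (x : Fin n → ℝ) : ℝ :=
  (∑ ℓ, pd ℓ (fun y => Gamma g ℓ i j y) x) - (∑ ℓ, pd i (fun y => Gamma g ℓ ℓ j y) x)
    + ∑ ℓ, ∑ s, (Gamma g ℓ ℓ s x * Gamma g s i j x - Gamma g ℓ i s x * Gamma g s ℓ j x)

/-- A function vanishes up to order `k` at `p`: it and all its partial derivatives of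
order `≤ k` vanish at `p`. -/
def VanishUpTo {n : ℕ} (k : ℕ) (f : (Fin n → ℝ) → ℝ) (p : Fin n → ℝ) : Prop :=
  ∀ l : List (Fin n), l.length ≤ k → iterPD l f p = 0


/-- The plain (flat) second order operator `Â f = ∑ᵢⱼ ∂ᵢ(Aⁱʲ ∂ⱼ f)` associated to a
matrix field `A`. -/
def opPlain {n : ℕ} (A : (Fin n → ℝ) → Matrix (Fin n) (Fin n) ℝ)
    (f : (Fin n → ℝ) → ℝ) (x : Fin n → ℝ) : ℝ :=
  ∑ i, ∑ j, pd i (fun y => A y i j * pd j f y) x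

end

section PartialDerivatives

variable {n : ℕ} {U : Set (Fin n → ℝ)} {x p : Fin n → ℝ} {f h : (Fin n → ℝ) → ℝ}

theorem pd_congr (i : Fin n) (hfh : f =ᶠ[nhds x] h) : pd i f x = pd i h x := by
  simp only [pd, hfh.fderiv_eq]

theorem pd_const (i : Fin n) (c : ℝ) : pd i (fun _ => c) x = 0 := by
  simp [pd]

theorem pd_add (i : Fin n) (hf : DifferentiableAt ℝ f x) (hh : DifferentiableAt ℝ h x) :
    pd i (fun y => f y + h y) x = pd i f x + pd i h x := by
  simp only [pd, fderiv_fun_add hf hh, _root_.add_apply]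

theorem pd_mul (i : Fin n) (hf : DifferentiableAt ℝ f x) (hh : DifferentiableAt ℝ h x) :
    pd i (fun y => f y * h y) x = pd i f x * h x + f x * pd i h x := by
  simp only [pd, fderiv_fun_mul hf hh, _root_.add_apply,
    _root_.smul_apply, smul_eq_mul]
  ring

theorem pd_sum {ι : Type*} (i : Fin n) (s : Finset ι) {F : ι → (Fin n → ℝ) → ℝ}
    (hF : ∀ a ∈ s, DifferentiableAt ℝ (F a) x) :
    pd i (fun y => ∑ a ∈ s, F a y) x = ∑ a ∈ s, pd i (F a) x := by
  simp only [pd, fderiv_fun_sum hF, _root_.sum_apply]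

theorem ContDiffOn.differentiableAt_of_isOpen (hf : ContDiffOn ℝ (⊤ : ℕ∞) f U) (hU : IsOpen U)
    (hx : x ∈ U) : DifferentiableAt ℝ f x :=
  (hf.contDiffAt (hU.mem_nhds hx)).differentiableAt (by simp)

theorem ContDiffOn.pd (hf : ContDiffOn ℝ (⊤ : ℕ∞) f U) (hU : IsOpen U) (i : Fin n) :
    ContDiffOn ℝ (⊤ : ℕ∞) (pd i f) U :=
  (hf.fderiv_of_isOpen hU (by simp)).clm_apply contDiffOn_const

theorem iterPD_concat (l : List (Fin n)) (i : Fin n) (f : (Fin n → ℝ) → ℝ) :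
    iterPD (l ++ [i]) f = iterPD l (pd i f) := by
  induction l with
  | nil => rfl
  | cons a l ih => simp only [List.cons_append, iterPD, ih]

theorem iterPD_eqOn (hU : IsOpen U) (hfh : Set.EqOn f h U) (l : List (Fin n)) :
    Set.EqOn (iterPD l f) (iterPD l h) U := by
  induction l with
  | nil => exact hfh
  | cons a l ih => exact fun x hx => pd_congr a (ih.eventuallyEq_of_mem (hU.mem_nhds hx))

theorem ContDiffOn.iterPD (hf : ContDiffOn ℝ (⊤ : ℕ∞) f U) (hU : IsOpen U) (l : List (Fin n)) :
    ContDiffOn ℝ (⊤ : ℕ∞) (iterPD l f) U := by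
  induction l with
  | nil => exact hf
  | cons a l ih => exact ih.pd hU a

theorem VanishUpTo.congr {k : ℕ} (hf : VanishUpTo k f p) (hU : IsOpen U) (hp : p ∈ U)
    (hfh : Set.EqOn h f U) : VanishUpTo k h p := fun l hl =>
  (iterPD_eqOn hU hfh l hp).trans (hf l hl)

theorem iterPD_zero (l : List (Fin n)) : iterPD l (fun _ => (0 : ℝ)) = fun _ => 0 := by
  induction l with
  | nil => rfl
  | cons a l ih => rw [iterPD, ih]; funext x; exact pd_const a 0

theorem VanishUpTo.zero (k : ℕ) : VanishUpTo k (fun _ => 0) p := fun l _ => by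
  rw [iterPD_zero]

theorem VanishUpTo.add {k : ℕ} (hU : IsOpen U) (hp : p ∈ U) (hfs : ContDiffOn ℝ (⊤ : ℕ∞) f U)
    (hhs : ContDiffOn ℝ (⊤ : ℕ∞) h U) (hf : VanishUpTo k f p) (hh : VanishUpTo k h p) :
    VanishUpTo k (fun y => f y + h y) p := by
  have key : ∀ l : List (Fin n),
      Set.EqOn (iterPD l fun y => f y + h y) (fun y => iterPD l f y + iterPD l h y) U := by
    intro l
    induction l with
    | nil => exact fun _ _ => rfl
    | cons a l ih =>
      intro x hx
      exact (pd_congr a (ih.eventuallyEq_of_mem (hU.mem_nhds hx))).trans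
        (pd_add a ((hfs.iterPD hU l).differentiableAt_of_isOpen hU hx)
          ((hhs.iterPD hU l).differentiableAt_of_isOpen hU hx))
  intro l hl
  rw [key l hp]
  simp only [hf l hl, hh l hl, add_zero]

theorem VanishUpTo.sum {ι : Type*} {k : ℕ} (hU : IsOpen U) (hp : p ∈ U) (s : Finset ι)
    {F : ι → (Fin n → ℝ) → ℝ} (hFs : ∀ a, ContDiffOn ℝ (⊤ : ℕ∞) (F a) U)
    (hF : ∀ a, VanishUpTo k (F a) p) : VanishUpTo k (fun y => ∑ a ∈ s, F a y) p := by
  classical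
  induction s using Finset.induction_on with
  | empty => simpa using VanishUpTo.zero k
  | insert a s ha ih =>
    simp only [Finset.sum_insert ha]
    exact (hF a).add hU hp (hFs a) (ContDiffOn.sum fun b _ => hFs b) ih

theorem VanishUpTo.pd {k : ℕ} (hf : VanishUpTo (k + 1) f p) (i : Fin n) :
    VanishUpTo k (pd i f) p := fun l hl => by
  rw [← iterPD_concat]
  exact hf _ (by simpa using hl)

theorem VanishUpTo.mul_left {k : ℕ} (hU : IsOpen U) (hp : p ∈ U)
    (hhs : ContDiffOn ℝ (⊤ : ℕ∞) h U) (hfs : ContDiffOn ℝ (⊤ : ℕ∞) f U) (hf : VanishUpTo k f p) :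
    VanishUpTo k (fun y => h y * f y) p := by
  have hf0 : f p = 0 := hf [] (by simp)
  induction k generalizing f h with
  | zero =>
    intro l hl
    obtain rfl : l = [] := by simpa using hl
    simp only [iterPD, hf0, mul_zero]
  | succ k ih =>
    intro l hl
    rcases List.eq_nil_or_concat l with rfl | ⟨l, i, rfl⟩
    · simp only [iterPD, hf0, mul_zero]
    · rw [List.concat_eq_append] at hl ⊢
      rw [iterPD_concat]
      have hl' : l.length ≤ k := by simpa using hl
      refine VanishUpTo.congr (f := fun y => _root_.pd i h y * f y + h y * _root_.pd i f y)
        (VanishUpTo.add hU hp ((hhs.pd hU i).mul hfs) (hhs.mul (hfs.pd hU i))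
          (ih (hhs.pd hU i) hfs (fun l hl => hf l (hl.trans k.le_succ)) hf0)
          (ih hhs (hfs.pd hU i) (hf.pd i) (hf.pd i [] (by simp)))) hU hp ?_ l hl'
      exact fun x hx => pd_mul i (hhs.differentiableAt_of_isOpen hU hx)
        (hfs.differentiableAt_of_isOpen hU hx)

end PartialDerivatives

section MatrixFields

variable {n : ℕ} {U : Set (Fin n → ℝ)} {x : Fin n → ℝ}
  {A B : (Fin n → ℝ) → Matrix (Fin n) (Fin n) ℝ}

/-- Entrywise partial derivative of a matrix field. -/
noncomputable def pdMat (k : Fin n) (A : (Fin n → ℝ) → Matrix (Fin n) (Fin n) ℝ)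
    (x : Fin n → ℝ) : Matrix (Fin n) (Fin n) ℝ :=
  Matrix.of fun i j => pd k (fun y => A y i j) x

theorem pdMat_congr (k : Fin n) (hAB : A =ᶠ[nhds x] B) : pdMat k A x = pdMat k B x := by
  ext i j
  exact pd_congr k (hAB.mono fun y hy => congrFun (congrFun hy i) j)

theorem pdMat_mul (k : Fin n) (hA : ∀ i j, DifferentiableAt ℝ (fun y => A y i j) x)
    (hB : ∀ i j, DifferentiableAt ℝ (fun y => B y i j) x) :
    pdMat k (fun y => A y * B y) x = pdMat k A x * B x + A x * pdMat k B x := by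
  ext i j
  simp only [pdMat, Matrix.of_apply, Matrix.mul_apply, Matrix.add_apply]
  rw [← Finset.sum_add_distrib]
  refine (pd_sum (F := fun a y => A y i a * B y a j) k _
    fun a _ => (hA i a).fun_mul (hB a j)).trans ?_
  exact Finset.sum_congr rfl fun a _ => pd_mul k (hA i a) (hB a j)

theorem pd_trace (k : Fin n) (hA : ∀ i j, DifferentiableAt ℝ (fun y => A y i j) x) :
    pd k (fun y => (A y).trace) x = (pdMat k A x).trace :=
  pd_sum k _ fun a _ => hA a a

theorem contDiffOn_matrix_det (hA : ∀ i j, ContDiffOn ℝ (⊤ : ℕ∞) (fun y => A y i j) U) :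
    ContDiffOn ℝ (⊤ : ℕ∞) (fun y => (A y).det) U := by
  simp only [Matrix.det_apply']
  exact ContDiffOn.sum fun σ _ => contDiffOn_const.mul (contDiffOn_prod fun i _ => hA _ _)

theorem contDiffOn_matrix_inv (hA : ∀ i j, ContDiffOn ℝ (⊤ : ℕ∞) (fun y => A y i j) U)
    (hdet : ∀ y ∈ U, IsUnit (A y).det) (i j : Fin n) :
    ContDiffOn ℝ (⊤ : ℕ∞) (fun y => (A y)⁻¹ i j) U := by
  simp only [Matrix.inv_def, Matrix.smul_apply, Ring.inverse_eq_inv', smul_eq_mul,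
    Matrix.adjugate_apply]
  refine ((contDiffOn_matrix_det hA).inv fun y hy => (hdet y hy).ne_zero).mul (contDiffOn_matrix_det fun a b => ?_)
  simp only [Matrix.updateRow_apply]
  split_ifs
  exacts [contDiffOn_const, hA a b]

theorem contDiffOn_matrix_mul (hA : ∀ i j, ContDiffOn ℝ (⊤ : ℕ∞) (fun y => A y i j) U)
    (hB : ∀ i j, ContDiffOn ℝ (⊤ : ℕ∞) (fun y => B y i j) U) (i j : Fin n) :
    ContDiffOn ℝ (⊤ : ℕ∞) (fun y => (A y * B y) i j) U := by
  simp only [Matrix.mul_apply]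
  exact ContDiffOn.sum fun a _ => (hA i a).mul (hB a j)

/-- Jacobi's formula. -/
theorem pd_det (k : Fin n) (hA : ∀ i j, DifferentiableAt ℝ (fun y => A y i j) x) :
    pd k (fun y => (A y).det) x = ((A x).adjugate * pdMat k A x).trace := by
  let D : ContinuousMultilinearMap ℝ (fun _ : Fin n => Fin n → ℝ) ℝ :=
    ⟨(Matrix.detRowAlternating (n := Fin n) (R := ℝ)).toMultilinearMap,
      Continuous.matrix_det continuous_id⟩
  have hA' : HasFDerivAt (fun y i j => A y i j)
      (ContinuousLinearMap.pi fun i => ContinuousLinearMap.pi fun j =>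
        fderiv ℝ (fun y => A y i j) x) x :=
    hasFDerivAt_pi.2 fun i => hasFDerivAt_pi.2 fun j => (hA i j).hasFDerivAt
  have hD := ((D.hasFDerivAt (fun i j => A x i j)).comp x hA').fderiv
  have hrow : ∀ i, (∑ j, (A x).adjugate j i * pdMat k A x i j) =
      ((A x).updateRow i (pdMat k A x i)).det := by
    intro i
    rw [← Matrix.cramer_transpose_apply, Matrix.cramer_eq_adjugate_mulVec,
      ← Matrix.adjugate_transpose]
    simp [Matrix.mulVec, dotProduct]
  have hpd : pd k (fun y => (A y).det) x = D.linearDeriv (fun i j => A x i j) (pdMat k A x) := by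
    have := congrArg (fun T => T (Pi.single k 1)) hD
    exact this
  refine hpd.trans ((D.linearDeriv_apply _ _).trans ?_)
  simp only [Matrix.trace, Matrix.diag_apply, Matrix.mul_apply]
  rw [Finset.sum_comm]
  exact Finset.sum_congr rfl fun i _ => (hrow i).symm

theorem pd_log_det (k : Fin n) (hA : ∀ i j, DifferentiableAt ℝ (fun y => A y i j) x)
    (hdetA : DifferentiableAt ℝ (fun y => (A y).det) x) (hx : IsUnit (A x).det) :
    pd k (fun y => Real.log (A y).det) x = ((A x)⁻¹ * pdMat k A x).trace := by
  rw [Matrix.inv_def, Matrix.smul_mul, Matrix.trace_smul, ← pd_det k hA, pd,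
    fderiv.log hdetA hx.ne_zero, Ring.inverse_eq_inv']
  rfl

theorem pdMat_inv (k : Fin n) (hU : IsOpen U) (hx : x ∈ U)
    (hA : ∀ i j, ContDiffOn ℝ (⊤ : ℕ∞) (fun y => A y i j) U)
    (hdet : ∀ y ∈ U, IsUnit (A y).det) :
    pdMat k (fun y => (A y)⁻¹) x = -((A x)⁻¹ * pdMat k A x * (A x)⁻¹) := by
  have h1 : pdMat k (fun y => (A y)⁻¹ * A y) x = 0 := by
    rw [pdMat_congr (B := fun _ => 1) k]
    · ext i j
      exact pd_const k _
    · filter_upwards [hU.mem_nhds hx] with y hy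
      exact Matrix.nonsing_inv_mul _ (hdet y hy)
  rw [pdMat_mul k (fun i j => (contDiffOn_matrix_inv hA hdet i j).differentiableAt_of_isOpen hU hx)
    fun i j => (hA i j).differentiableAt_of_isOpen hU hx] at h1
  have h2 := congrArg (· * (A x)⁻¹) (eq_neg_of_add_eq_zero_left h1)
  simpa [Matrix.mul_assoc, Matrix.mul_nonsing_inv _ (hdet x hx)] using h2

end MatrixFields

section Christoffel

variable {n : ℕ} {U : Set (Fin n → ℝ)} {x : Fin n → ℝ}
  {g gbar : (Fin n → ℝ) → Matrix (Fin n) (Fin n) ℝ}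

theorem IsMetricOn.pd_symm (hg : IsMetricOn U g) (hU : IsOpen U) (hx : x ∈ U) (k i j : Fin n) :
    pd k (fun y => g y i j) x = pd k (fun y => g y j i) x := by
  apply pd_congr
  filter_upwards [hU.mem_nhds hx] with y hy
  exact (hg.symm y hy).apply j i

theorem IsMetricOn.differentiableAt (hg : IsMetricOn U g) (hU : IsOpen U) (hx : x ∈ U)
    (i j : Fin n) : DifferentiableAt ℝ (fun y => g y i j) x :=
  (hg.smooth i j).differentiableAt_of_isOpen hU hx

theorem IsMetricOn.gamma_symm (hg : IsMetricOn U g) (hU : IsOpen U) (hx : x ∈ U)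
    (k i j : Fin n) : Gamma g k i j x = Gamma g k j i x := by
  simp only [Gamma]
  congr 1
  refine Finset.sum_congr rfl fun l _ => ?_
  rw [hg.pd_symm hU hx l i j]
  ring

theorem IsMetricOn.contDiffOn_gamma (hg : IsMetricOn U g) (hU : IsOpen U) (k i j : Fin n) :
    ContDiffOn ℝ (⊤ : ℕ∞) (Gamma g k i j) U := by
  have : Gamma g k i j = fun x => (1/2) * ∑ ℓ, (g x)⁻¹ k ℓ *
    (pd i (fun y => g y ℓ j) x + pd j (fun y => g y ℓ i) x - pd ℓ (fun y => g y i j) x) := rfl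
  rw [this]
  refine contDiffOn_const.mul (ContDiffOn.sum fun l _ => ?_)
  exact (contDiffOn_matrix_inv hg.smooth hg.nondeg k l).mul
    ((((hg.smooth _ _).pd hU i).add ((hg.smooth _ _).pd hU j)).sub ((hg.smooth _ _).pd hU l))

/-- The matrix `(Γ^s_{k i})_{s i}` of the connection form of `g` in the direction `k`. -/
noncomputable def gammaMat (g : (Fin n → ℝ) → Matrix (Fin n) (Fin n) ℝ) (k : Fin n)
    (x : Fin n → ℝ) : Matrix (Fin n) (Fin n) ℝ :=
  Matrix.of fun s i => Gamma g s k i x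

/-- The Levi-Civita connection is metric. -/
theorem IsMetricOn.pdMat_eq (hg : IsMetricOn U g) (hU : IsOpen U) (hx : x ∈ U) (k : Fin n) :
    pdMat k g x = g x * gammaMat g k x + (gammaMat g k x)ᵀ * g x := by
  set B : Matrix (Fin n) (Fin n) ℝ := Matrix.of fun l i =>
    pd k (fun y => g y l i) x + pd i (fun y => g y l k) x - pd l (fun y => g y k i) x with hB
  have hC : gammaMat g k x = (1 / 2 : ℝ) • ((g x)⁻¹ * B) := by
    ext s i
    simp [gammaMat, Gamma, hB, Matrix.mul_apply]
  have hgC : g x * gammaMat g k x = (1 / 2 : ℝ) • B := by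
    rw [hC, Matrix.mul_smul, ← Matrix.mul_assoc, Matrix.mul_nonsing_inv _ (hg.nondeg x hx),
      Matrix.one_mul]
  have hgC' : (gammaMat g k x)ᵀ * g x = (g x * gammaMat g k x)ᵀ := by
    rw [Matrix.transpose_mul, (hg.symm x hx).eq]
  rw [hgC', hgC]
  ext i j
  simp only [pdMat, hB, Matrix.add_apply, Matrix.smul_apply, Matrix.transpose_apply,
    Matrix.of_apply, smul_eq_mul]
  rw [hg.pd_symm hU hx k j i, hg.pd_symm hU hx i j k, hg.pd_symm hU hx j i k]
  ring

theorem IsMetricOn.pd_log_det (hg : IsMetricOn U g) (hU : IsOpen U) (hx : x ∈ U) (k : Fin n) :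
    pd k (fun y => Real.log (g y).det) x = 2 * (gammaMat g k x).trace := by
  have hu := hg.nondeg x hx
  rw [_root_.pd_log_det k (hg.differentiableAt hU hx)
    ((contDiffOn_matrix_det hg.smooth).differentiableAt_of_isOpen hU hx) hu,
    hg.pdMat_eq hU hx, Matrix.mul_add, Matrix.trace_add, ← Matrix.mul_assoc,
    Matrix.nonsing_inv_mul _ hu, Matrix.one_mul, Matrix.trace_mul_comm, Matrix.mul_assoc,
    Matrix.mul_nonsing_inv _ hu, Matrix.mul_one, Matrix.trace_transpose]
  ring

theorem IsMetricOn.pdMat_inv_eq (hg : IsMetricOn U g) (hU : IsOpen U) (hx : x ∈ U) (k : Fin n) :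
    pdMat k (fun y => (g y)⁻¹) x =
      -(gammaMat g k x * (g x)⁻¹ + (g x)⁻¹ * (gammaMat g k x)ᵀ) := by
  have hu := hg.nondeg x hx
  rw [pdMat_inv k hU hx hg.smooth hg.nondeg, hg.pdMat_eq hU hx, Matrix.mul_add, Matrix.add_mul,
    ← Matrix.mul_assoc, Matrix.nonsing_inv_mul _ hu, Matrix.one_mul,
    Matrix.mul_assoc _ _ (g x)⁻¹, Matrix.mul_assoc _ _ (g x)⁻¹, Matrix.mul_nonsing_inv _ hu,
    Matrix.mul_one]

theorem pd_trace_inv_mul (hg : IsMetricOn U g) (hgbar : IsMetricOn U gbar) (hU : IsOpen U)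
    (hx : x ∈ U) (k : Fin n) :
    pd k (fun y => ((gbar y)⁻¹ * g y).trace) x =
      -2 * ((gammaMat gbar k x - gammaMat g k x) * ((gbar x)⁻¹ * g x)).trace := by
  have hinv : ∀ i j, DifferentiableAt ℝ (fun y => (gbar y)⁻¹ i j) x := fun i j =>
    (contDiffOn_matrix_inv hgbar.smooth hgbar.nondeg i j).differentiableAt_of_isOpen hU hx
  have hsymm : ((gbar x)⁻¹)ᵀ = (gbar x)⁻¹ := by
    rw [Matrix.transpose_nonsing_inv, (hgbar.symm x hx).eq]
  have hflip : ∀ C : Matrix (Fin n) (Fin n) ℝ,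
      ((gbar x)⁻¹ * (Cᵀ * g x)).trace = (C * ((gbar x)⁻¹ * g x)).trace := by
    intro C
    rw [← Matrix.trace_transpose, Matrix.transpose_mul, Matrix.transpose_mul, hsymm,
      (hg.symm x hx).eq, Matrix.transpose_transpose, Matrix.mul_assoc, Matrix.trace_mul_comm,
      Matrix.mul_assoc]
  have hmul : ∀ C : Matrix (Fin n) (Fin n) ℝ,
      ((gbar x)⁻¹ * (g x * C)).trace = (C * ((gbar x)⁻¹ * g x)).trace := by
    intro C
    rw [← Matrix.mul_assoc, Matrix.trace_mul_comm]
  have hdiff : ∀ i j, DifferentiableAt ℝ (fun y => ((gbar y)⁻¹ * g y) i j) x := fun i j =>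
    (contDiffOn_matrix_mul (contDiffOn_matrix_inv hgbar.smooth hgbar.nondeg) hg.smooth i
      j).differentiableAt_of_isOpen hU hx
  rw [pd_trace k hdiff, pdMat_mul k hinv (hg.differentiableAt hU hx), hgbar.pdMat_inv_eq hU hx,
    hg.pdMat_eq hU hx]
  simp only [Matrix.neg_mul, Matrix.add_mul, Matrix.mul_add, Matrix.sub_mul, Matrix.trace_add,
    Matrix.trace_sub, Matrix.trace_neg, Matrix.mul_assoc, hflip, hmul]
  ring

/-- The conformal weight `|det gbar / det g|^{1/(n+1)}` in `Lfield`. -/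
noncomputable def detWeight (g gbar : (Fin n → ℝ) → Matrix (Fin n) (Fin n) ℝ)
    (x : Fin n → ℝ) : ℝ :=
  Real.exp ((Real.log (gbar x).det + -1 * Real.log (g x).det) * (1 / ((n : ℝ) + 1)))

theorem Lfield_eq (hg : IsMetricOn U g) (hgbar : IsMetricOn U gbar) (hx : x ∈ U) :
    Lfield g gbar x = detWeight g gbar x • ((gbar x)⁻¹ * g x) := by
  have h1 := (hg.nondeg x hx).ne_zero
  have h2 := (hgbar.nondeg x hx).ne_zero
  rw [Lfield, detWeight, Real.rpow_def_of_pos (abs_pos.2 (div_ne_zero h2 h1)), Real.log_abs,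
    Real.log_div h2 h1]
  ring_nf

theorem contDiffOn_detWeight (hg : IsMetricOn U g) (hgbar : IsMetricOn U gbar) :
    ContDiffOn ℝ (⊤ : ℕ∞) (detWeight g gbar) U :=
  ((((contDiffOn_matrix_det hgbar.smooth).log fun y hy => (hgbar.nondeg y hy).ne_zero).add
    (contDiffOn_const.mul ((contDiffOn_matrix_det hg.smooth).log
      fun y hy => (hg.nondeg y hy).ne_zero))).mul contDiffOn_const).exp

theorem pd_detWeight (hg : IsMetricOn U g) (hgbar : IsMetricOn U gbar) (hU : IsOpen U)
    (hx : x ∈ U) (k : Fin n) :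
    pd k (detWeight g gbar) x =
      detWeight g gbar x * (2 * (gammaMat gbar k x - gammaMat g k x).trace / ((n : ℝ) + 1)) := by
  have hd : ∀ {A : (Fin n → ℝ) → Matrix (Fin n) (Fin n) ℝ}, IsMetricOn U A →
      DifferentiableAt ℝ (fun y => Real.log (A y).det) x := fun hA =>
    ((contDiffOn_matrix_det hA.smooth).differentiableAt_of_isOpen hU hx).log
      (hA.nondeg x hx).ne_zero
  have h1 := (hd hg).const_mul (-1)
  have h2 := (hd hgbar).fun_add h1
  have h3 := h2.mul_const (1 / ((n : ℝ) + 1))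
  have hexp : pd k (detWeight g gbar) x = detWeight g gbar x *
      pd k (fun y => (Real.log (gbar y).det + -1 * Real.log (g y).det) * (1 / ((n : ℝ) + 1))) x := by
    simp only [pd]
    rw [show detWeight g gbar = fun y => Real.exp ((Real.log (gbar y).det +
      -1 * Real.log (g y).det) * (1 / ((n : ℝ) + 1))) from rfl, fderiv_exp h3]
    rfl
  rw [hexp, pd_mul k h2 (differentiableAt_const _), pd_const, pd_add k (hd hgbar) h1,
    pd_mul k (differentiableAt_const _) (hd hg), pd_const, hg.pd_log_det hU hx,
    hgbar.pd_log_det hU hx, Matrix.trace_sub]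
  ring

/-- The differential of `½ tr L` in terms of the projective difference one-form. -/
theorem pd_half_trace_Lfield (hg : IsMetricOn U g) (hgbar : IsMetricOn U gbar) (hU : IsOpen U)
    (hx : x ∈ U) {φ : Fin n → ℝ}
    (hφ : ∀ k i j, Gamma gbar k i j x - Gamma g k i j x =
      (if k = i then φ j else 0) + (if k = j then φ i else 0)) (k : Fin n) :
    pd k (fun y => (1 / 2) * (Lfield g gbar y).trace) x =
      -(detWeight g gbar x * ((g x * (gbar x)⁻¹) *ᵥ φ) k) := by
  have hE : gammaMat gbar k x - gammaMat g k x =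
      Matrix.vecMulVec (Pi.single k 1) φ + φ k • (1 : Matrix (Fin n) (Fin n) ℝ) := by
    ext s i
    simp only [gammaMat, Matrix.sub_apply, Matrix.of_apply, hφ, Matrix.add_apply,
      Matrix.vecMulVec_apply, Matrix.smul_apply, Matrix.one_apply, Pi.single_apply, smul_eq_mul]
    split_ifs <;> simp
  have hn : (n : ℝ) + 1 ≠ 0 := by positivity
  have htr : (gammaMat gbar k x - gammaMat g k x).trace = ((n : ℝ) + 1) * φ k := by
    rw [hE, Matrix.trace_add, Matrix.trace_vecMulVec, Matrix.trace_smul, Matrix.trace_one,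
      single_one_dotProduct, Fintype.card_fin, smul_eq_mul]
    ring
  have hsymm : ((gbar x)⁻¹ * g x)ᵀ = g x * (gbar x)⁻¹ := by
    rw [Matrix.transpose_mul, Matrix.transpose_nonsing_inv, (hgbar.symm x hx).eq,
      (hg.symm x hx).eq]
  have htr2 : ((gammaMat gbar k x - gammaMat g k x) * ((gbar x)⁻¹ * g x)).trace =
      ((g x * (gbar x)⁻¹) *ᵥ φ) k + φ k * ((gbar x)⁻¹ * g x).trace := by
    rw [hE, Matrix.add_mul, Matrix.trace_add, Matrix.smul_mul, Matrix.one_mul, Matrix.trace_smul,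
      Matrix.vecMulVec_mul, Matrix.trace_vecMulVec, single_one_dotProduct, ← hsymm,
      Matrix.mulVec_transpose, smul_eq_mul]
  have hcongr : pd k (fun y => (1 / 2) * (Lfield g gbar y).trace) x =
      pd k (fun y => (1 / 2) * (detWeight g gbar y * ((gbar y)⁻¹ * g y).trace)) x := by
    apply pd_congr
    filter_upwards [hU.mem_nhds hx] with y hy
    rw [Lfield_eq hg hgbar hy, Matrix.trace_smul, smul_eq_mul]
  have hρ := (contDiffOn_detWeight hg hgbar).differentiableAt_of_isOpen hU hx
  have ht : DifferentiableAt ℝ (fun y => ((gbar y)⁻¹ * g y).trace) x :=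
    (ContDiffOn.sum fun i _ => contDiffOn_matrix_mul
      (contDiffOn_matrix_inv hgbar.smooth hgbar.nondeg) hg.smooth i
      i).differentiableAt_of_isOpen hU hx
  rw [hcongr, pd_mul k (differentiableAt_const _) (hρ.fun_mul ht), pd_const, pd_mul k hρ ht,
    pd_trace_inv_mul hg hgbar hU hx, pd_detWeight hg hgbar hU hx, htr, htr2]
  field_simp
  ring

end Christoffel

/-- A symmetric bilinear map whose quadratic form sends every vector to a multiple of itself is
the symmetrization of a one-form with the identity. -/
theorem exists_oneForm_of_quadratic_collinear {n : ℕ} {D : Fin n → Fin n → Fin n → ℝ}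
    (hsymm : ∀ k i j, D k i j = D k j i)
    (hD : ∀ v : Fin n → ℝ, v ≠ 0 → ∃ c : ℝ, ∀ k, ∑ i, ∑ j, D k i j * v i * v j = c * v k) :
    ∃ φ : Fin n → ℝ, ∀ k i j,
      D k i j = (if k = i then φ j else 0) + (if k = j then φ i else 0) := by
  have hdiag : ∀ i k, k ≠ i → D k i i = 0 := by
    intro i k hk
    obtain ⟨c, hc⟩ := hD (Pi.single i 1) (by simp)
    simpa [Pi.single_apply, hk] using hc k
  have hpair : ∀ i j, i ≠ j → ∀ s : ℝ, ∃ c : ℝ, ∀ k,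
      D k i i + 2 * s * D k i j + s ^ 2 * D k j j =
        c * ((if k = i then 1 else 0) + s * (if k = j then 1 else 0)) := by
    intro i j hij s
    have hv : (Pi.single i 1 + s • Pi.single j 1 : Fin n → ℝ) ≠ 0 := fun h => by
      simpa [hij] using congrFun h i
    obtain ⟨c, hc⟩ := hD _ hv
    refine ⟨c, fun k => ?_⟩
    have := hc k
    simp only [Pi.add_apply, Pi.smul_apply, smul_eq_mul, mul_add, add_mul,
      Finset.sum_add_distrib, Pi.single_apply, mul_ite, ite_mul, mul_one, mul_zero, zero_mul,
      Finset.sum_ite_eq', Finset.mem_univ, if_true] at this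
    rw [hsymm k j i] at this
    simp only [mul_ite, mul_add, mul_one, mul_zero]
    linarith
  refine ⟨fun i => D i i i / 2, fun k i j => ?_⟩
  by_cases hij : i = j
  · subst hij
    by_cases hk : k = i
    · subst hk
      simp
    · simp [hk, hdiag i k hk]
  · obtain ⟨c, hc⟩ := hpair i j hij 1
    obtain ⟨d, hd⟩ := hpair i j hij (-1)
    have hji : j ≠ i := fun h => hij h.symm
    have e1 := hc i
    have e2 := hc j
    have e3 := hd i
    have e4 := hd j
    simp only [hij, hji, if_true, if_false, hdiag _ _ hij, hdiag _ _ hji] at e1 e2 e3 e4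
    by_cases hki : k = i
    · subst hki
      simp only [hij, if_true, if_false]
      linarith
    · by_cases hkj : k = j
      · subst hkj
        simp only [hki, if_true, if_false]
        linarith
      · have e5 := hc k
        simp only [hki, hkj, if_false, hdiag _ _ hki, hdiag _ _ hkj] at e5 ⊢
        linarith

section Geodesics

variable {n : ℕ} {U : Set (Fin n → ℝ)} {x v : Fin n → ℝ}
  {g gbar : (Fin n → ℝ) → Matrix (Fin n) (Fin n) ℝ}

/-- The geodesic spray of `g` on the tangent bundle of `ℝⁿ`. -/
noncomputable def geodesicSpray (g : (Fin n → ℝ) → Matrix (Fin n) (Fin n) ℝ)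
    (z : (Fin n → ℝ) × (Fin n → ℝ)) : (Fin n → ℝ) × (Fin n → ℝ) :=
  (z.2, fun k => -∑ i, ∑ j, Gamma g k i j z.1 * z.2 i * z.2 j)

theorem IsMetricOn.contDiffOn_geodesicSpray (hg : IsMetricOn U g) (hU : IsOpen U)
    (s : Set (Fin n → ℝ)) : ContDiffOn ℝ (⊤ : ℕ∞) (geodesicSpray g) (U ×ˢ s) := by
  refine contDiffOn_snd.prodMk (contDiffOn_pi.2 fun k =>
    (ContDiffOn.sum fun i _ => ContDiffOn.sum fun j _ => ?_).neg)
  have hc : ∀ a : Fin n, ContDiffOn ℝ (⊤ : ℕ∞)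
      (fun z : (Fin n → ℝ) × (Fin n → ℝ) => z.2 a) (U ×ˢ s) := fun a =>
    contDiffOn_pi.1 contDiffOn_snd a
  exact (((hg.contDiffOn_gamma hU k i j).comp contDiffOn_fst fun z hz => hz.1).mul (hc i)).mul
    (hc j)

theorem IsMetricOn.exists_geodesic (hg : IsMetricOn U g) (hU : IsOpen U) (hx : x ∈ U)
    (hv : v ≠ 0) : ∃ (γ : ℝ → Fin n → ℝ) (I : Set ℝ), (0 : ℝ) ∈ I ∧ IsGeodesicOn U g γ I ∧
      (∀ t ∈ I, ∃ k, deriv (fun s => γ s k) t ≠ 0) ∧ γ 0 = x ∧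
      ∀ k, deriv (fun s => γ s k) 0 = v k := by
  set W : Set ((Fin n → ℝ) × (Fin n → ℝ)) := U ×ˢ {0}ᶜ with hW
  have hWo : IsOpen W := hU.prod isOpen_compl_singleton
  have hxv : (x, v) ∈ W := ⟨hx, hv⟩
  have hspray := hg.contDiffOn_geodesicSpray hU {0}ᶜ
  obtain ⟨α, hα0, ε, hε, hα⟩ := ((hspray.contDiffAt (hWo.mem_nhds hxv)).of_le
    (by exact_mod_cast le_top)
    ).exists_forall_mem_closedBall_exists_eq_forall_mem_Ioo_hasDerivAt₀ 0
  rw [zero_sub, zero_add] at hα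
  have hev : ∀ᶠ t in nhds (0 : ℝ), α t ∈ W ∧ t ∈ Set.Ioo (-ε) ε :=
    ((hα 0 ⟨by linarith, hε⟩).continuousAt.eventually_mem
      (by rw [hα0]; exact hWo.mem_nhds hxv)).and (Ioo_mem_nhds (by linarith) hε)
  obtain ⟨δ, hδ, hball⟩ := Metric.nhds_basis_closedBall.eventually_iff.1 hev
  rw [Real.closedBall_eq_Icc, zero_sub, zero_add] at hball
  have hsmooth : ContDiffOn ℝ (⊤ : ℕ∞) α (Set.Icc (-δ) δ) := by
    refine ODE.contDiffOn_enat_Icc_of_hasDerivWithinAt (f := fun _ => geodesicSpray g) (u := W) ?_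
      (fun t ht => (hα t (hball ht).2).hasDerivWithinAt) fun t ht => (hball ht).1
    exact hspray.comp contDiffOn_snd fun z hz => hz.2
  have hsub : Set.Ioo (-δ) δ ⊆ Set.Icc (-δ) δ := Set.Ioo_subset_Icc_self
  have hder : ∀ t ∈ Set.Ioo (-δ) δ, HasDerivAt α (geodesicSpray g (α t)) t := fun t ht =>
    hα t (hball (hsub ht)).2
  have hd1 : ∀ t ∈ Set.Ioo (-δ) δ, ∀ k, HasDerivAt (fun s => (α s).1 k) ((α t).2 k) t :=
    fun t ht k => hasDerivAt_pi.1 (hder t ht).fst k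
  have hd2 : ∀ t ∈ Set.Ioo (-δ) δ, ∀ k, HasDerivAt (fun s => (α s).2 k)
      (-∑ i, ∑ j, Gamma g k i j (α t).1 * (α t).2 i * (α t).2 j) t :=
    fun t ht k => hasDerivAt_pi.1 (hder t ht).snd k
  have h0 : (0 : ℝ) ∈ Set.Ioo (-δ) δ := ⟨by linarith, hδ⟩
  refine ⟨fun t => (α t).1, Set.Ioo (-δ) δ, h0, ⟨⟨isOpen_Ioo, Set.ordConnected_Ioo⟩, fun k => ?_,
    fun t ht => (hball (hsub ht)).1.1, fun t ht k => ?_⟩, fun t ht => ?_, by simp [hα0],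
    fun k => by rw [(hd1 0 h0 k).deriv, hα0]⟩
  · exact contDiffOn_pi.1 (contDiff_fst.comp_contDiffOn (hsmooth.mono hsub)) k
  · have hdd : deriv (fun s => (α s).1 k) =ᶠ[nhds t] fun s => (α s).2 k := by
      filter_upwards [isOpen_Ioo.mem_nhds ht] with s hs
      exact (hd1 s hs k).deriv
    rw [hdd.deriv_eq, (hd2 t ht k).deriv]
    simp only [(hd1 t ht _).deriv, neg_add_cancel]
  · obtain ⟨k, hk⟩ := Function.ne_iff.1 (hball (hsub ht)).1.2
    exact ⟨k, by rw [(hd1 t ht k).deriv]; exact hk⟩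

theorem ProjEquiv.exists_collinear (hproj : ProjEquiv U g gbar) (hg : IsMetricOn U g)
    (hU : IsOpen U) (hx : x ∈ U) (hv : v ≠ 0) :
    ∃ c : ℝ, ∀ k, ∑ i, ∑ j, (Gamma gbar k i j x - Gamma g k i j x) * v i * v j = c * v k := by
  obtain ⟨γ, I, h0, hγ, hvel, hγ0, hγv⟩ := hg.exists_geodesic hU hx hv
  obtain ⟨φ, J, hJ, hφ, -, hφJ, hφ', hγφ⟩ := hproj γ I hγ hvel
  obtain ⟨s, hs, hφs⟩ : (0 : ℝ) ∈ φ '' J := hφJ ▸ h0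
  have hφd : ∀ t ∈ J, DifferentiableAt ℝ φ t := fun t ht =>
    (hφ.contDiffAt (hJ.1.mem_nhds ht)).differentiableAt (by simp)
  have hφdd : DifferentiableAt ℝ (deriv φ) s :=
    (((contDiffOn_infty_iff_deriv_of_isOpen hJ.1).1 hφ).2.contDiffAt
      (hJ.1.mem_nhds hs)).differentiableAt (by simp)
  have hγd : ∀ k, ∀ t ∈ I, DifferentiableAt ℝ (fun r => γ r k) t := fun k t ht =>
    ((hγ.smooth k).contDiffAt (hγ.interval.1.mem_nhds ht)).differentiableAt (by simp)
  have hγdd : ∀ k, DifferentiableAt ℝ (deriv fun r => γ r k) 0 := fun k =>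
    (((contDiffOn_infty_iff_deriv_of_isOpen hγ.interval.1).1 (hγ.smooth k)).2.contDiffAt
      (hγ.interval.1.mem_nhds h0)).differentiableAt (by simp)
  have hd : ∀ k, ∀ t ∈ J, deriv (fun r => (γ ∘ φ) r k) t =
      deriv (fun r => γ r k) (φ t) * deriv φ t := fun k t ht =>
    ((hγd k (φ t) (hφJ ▸ Set.mem_image_of_mem φ ht)).hasDerivAt.comp t
      (hφd t ht).hasDerivAt).deriv
  have hdd : ∀ k, deriv (deriv fun r => (γ ∘ φ) r k) s =
      deriv (deriv fun r => γ r k) 0 * deriv φ s * deriv φ s + v k * deriv (deriv φ) s := by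
    intro k
    have hev : (deriv fun r => (γ ∘ φ) r k) =ᶠ[nhds s]
        fun t => deriv (fun r => γ r k) (φ t) * deriv φ t := by
      filter_upwards [hJ.1.mem_nhds hs] with t ht
      exact hd k t ht
    have h1 : HasDerivAt (deriv fun r => γ r k) (deriv (deriv fun r => γ r k) 0) (φ s) := by
      rw [hφs]
      exact (hγdd k).hasDerivAt
    have h2 := (h1.comp s (hφd s hs).hasDerivAt).fun_mul hφdd.hasDerivAt
    rw [hev.deriv_eq]
    refine h2.deriv.trans ?_
    simp only [Function.comp_apply, hφs, hγv]
  refine ⟨-deriv (deriv φ) s / deriv φ s ^ 2, fun k => ?_⟩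
  have e1 := hγ.eqn 0 h0 k
  have e2 := hγφ.eqn s hs k
  rw [hdd k] at e2
  simp only [hd _ s hs] at e2
  simp only [hφs, hγv, hγ0, Function.comp_apply] at e1 e2
  have hne := hφ' s hs
  have e3 : ∑ i, ∑ j, Gamma gbar k i j x * (v i * deriv φ s) * (v j * deriv φ s) =
      deriv φ s ^ 2 * ∑ i, ∑ j, Gamma gbar k i j x * v i * v j := by
    simp only [Finset.mul_sum]
    exact Finset.sum_congr rfl fun i _ => Finset.sum_congr rfl fun j _ => by ring
  rw [e3] at e2
  simp only [sub_mul, Finset.sum_sub_distrib]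
  field_simp
  linear_combination e2 - deriv φ s ^ 2 * e1

/-- The Levi-Civita connections of projectively equivalent metrics differ by the symmetrization
of a one-form with the identity. -/
theorem ProjEquiv.exists_oneForm (hproj : ProjEquiv U g gbar) (hg : IsMetricOn U g)
    (hgbar : IsMetricOn U gbar) (hU : IsOpen U) (hx : x ∈ U) :
    ∃ φ : Fin n → ℝ, ∀ k i j, Gamma gbar k i j x - Gamma g k i j x =
      (if k = i then φ j else 0) + (if k = j then φ i else 0) :=
  exists_oneForm_of_quadratic_collinear
    (fun k i j => by rw [hg.gamma_symm hU hx k i j, hgbar.gamma_symm hU hx k i j])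
    fun _ hv => hproj.exists_collinear hg hU hx hv

/-- The one-form relating the connections of projectively equivalent metrics, recovered from
the differential of `½ tr L`. -/
noncomputable def projOneForm (g gbar : (Fin n → ℝ) → Matrix (Fin n) (Fin n) ℝ) (i : Fin n)
    (x : Fin n → ℝ) : ℝ :=
  ∑ k, -1 * ((detWeight g gbar x)⁻¹ * (gbar x * (g x)⁻¹) i k) *
    pd k (fun y => (1 / 2) * (Lfield g gbar y).trace) x

theorem ProjEquiv.gamma_sub_gamma (hproj : ProjEquiv U g gbar) (hg : IsMetricOn U g)
    (hgbar : IsMetricOn U gbar) (hU : IsOpen U) (hx : x ∈ U) (k i j : Fin n) :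
    Gamma gbar k i j x - Gamma g k i j x =
      (if k = i then 1 else 0) * projOneForm g gbar j x +
        (if k = j then 1 else 0) * projOneForm g gbar i x := by
  obtain ⟨φ, hφ⟩ := hproj.exists_oneForm hg hgbar hU hx
  have hρ : detWeight g gbar x ≠ 0 := (Real.exp_pos _).ne'
  have hinv : (gbar x * (g x)⁻¹) * (g x * (gbar x)⁻¹) = 1 := by
    rw [Matrix.mul_assoc, ← Matrix.mul_assoc (g x)⁻¹, Matrix.nonsing_inv_mul _ (hg.nondeg x hx),
      Matrix.one_mul, Matrix.mul_nonsing_inv _ (hgbar.nondeg x hx)]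
  have hform : ∀ a, projOneForm g gbar a x = φ a := by
    intro a
    calc projOneForm g gbar a x
        = ∑ b, (gbar x * (g x)⁻¹) a b * ((g x * (gbar x)⁻¹) *ᵥ φ) b := by
          refine Finset.sum_congr rfl fun b _ => ?_
          rw [pd_half_trace_Lfield hg hgbar hU hx hφ b]
          field_simp
      _ = ((gbar x * (g x)⁻¹) *ᵥ ((g x * (gbar x)⁻¹) *ᵥ φ)) a := rfl
      _ = φ a := by rw [Matrix.mulVec_mulVec, hinv, Matrix.one_mulVec]
  rw [hφ, hform, hform]
  simp only [ite_mul, one_mul, zero_mul]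

end Geodesics

theorem contDiffOn_half_trace_Lfield {n : ℕ} {U : Set (Fin n → ℝ)}
    {g gbar : (Fin n → ℝ) → Matrix (Fin n) (Fin n) ℝ} (hg : IsMetricOn U g)
    (hgbar : IsMetricOn U gbar) :
    ContDiffOn ℝ (⊤ : ℕ∞) (fun y => (1 / 2) * (Lfield g gbar y).trace) U := by
  refine contDiffOn_const.mul (ContDiffOn.sum fun i _ => ?_)
  refine ((contDiffOn_detWeight hg hgbar).mul (contDiffOn_matrix_mul
    (contDiffOn_matrix_inv hgbar.smooth hgbar.nondeg) hg.smooth i i)).congr fun y hy => ?_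
  rw [Lfield_eq hg hgbar hy]
  rfl

theorem connections_coincide_up_to_lower_order {n : ℕ} (hn : 2 ≤ n) (U : Set (Fin n → ℝ)) (hUo : IsOpen U) (hUc : IsConnected U)
    (g gbar : (Fin n → ℝ) → Matrix (Fin n) (Fin n) ℝ)
    (hg : IsMetricOn U g) (hgbar : IsMetricOn U gbar)
    (hproj : ProjEquiv U g gbar) (k : ℕ) (hk : 1 ≤ k)
    (p : Fin n → ℝ) (hp : p ∈ U)
    (hlam : ∀ l : List (Fin n), 1 ≤ l.length → l.length ≤ k →
      iterPD l (fun y => (1/2) * (Lfield g gbar y).trace) p = 0) :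
    ∀ l : List (Fin n), l.length ≤ k - 1 → ∀ i j m : Fin n,
      iterPD l (fun x => Gamma gbar i j m x - Gamma g i j m x) p = 0 := by

  set lam : (Fin n → ℝ) → ℝ := fun y => (1/2) * (Lfield g gbar y).trace
  have hlam_smooth : ContDiffOn ℝ (⊤ : ℕ∞) lam U := contDiffOn_half_trace_Lfield hg hgbar
  have hdlam : ∀ a, VanishUpTo (k - 1) (pd a lam) p := fun a l hl => by
    rw [← iterPD_concat]
    exact hlam _ (by simp) (by simp only [List.length_append, List.length_singleton]; omega)
  have hcoeff : ∀ s a, ContDiffOn ℝ (⊤ : ℕ∞)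
      (fun y => -1 * ((detWeight g gbar y)⁻¹ * (gbar y * (g y)⁻¹) s a)) U := fun s a =>
    contDiffOn_const.mul (((contDiffOn_detWeight hg hgbar).inv
      fun y _ => (Real.exp_pos _).ne').mul
      (contDiffOn_matrix_mul hgbar.smooth (contDiffOn_matrix_inv hg.smooth hg.nondeg) s a))
  have hform_smooth : ∀ s, ContDiffOn ℝ (⊤ : ℕ∞) (projOneForm g gbar s) U := fun s =>
    ContDiffOn.sum fun a _ => (hcoeff s a).mul (hlam_smooth.pd hUo a)
  have hform : ∀ s, VanishUpTo (k - 1) (projOneForm g gbar s) p := fun s =>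
    VanishUpTo.sum hUo hp Finset.univ (fun a => (hcoeff s a).mul (hlam_smooth.pd hUo a))
      fun a => VanishUpTo.mul_left hUo hp (hcoeff s a) (hlam_smooth.pd hUo a) (hdlam a)
  intro l hl i j m
  exact VanishUpTo.congr
    (VanishUpTo.add hUo hp (contDiffOn_const.mul (hform_smooth m))
      (contDiffOn_const.mul (hform_smooth j))
      (VanishUpTo.mul_left hUo hp contDiffOn_const (hform_smooth m) (hform m))
      (VanishUpTo.mul_left hUo hp contDiffOn_const (hform_smooth j) (hform j)))
    hUo hp (fun x hx => hproj.gamma_sub_gamma hg hgbar hUo hx i j m) l hl
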